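/- arXiv:2501.06486 — 2 statements merged into one kernel-verified Lean document; each statement's English description precedes it below -/
import Mathlib

section
/- Let G be a measurable group, H a measurable space with a measurable left G-action, σ an s-finite left-translation-invariant measure on G, and ν an s-finite G-equivariant kernel from G to H (i.e., ν(a b) = (ν b).map(a • ·) for all a, b ∈ G). Then the 2-group Haar measure μ = σ ⊗ ν on G × H is invariant under every whiskering map: for all a ∈ G, the pushforward of μ along (b, γ) ↦ (a b, a • γ) equals μ. -/
open MeasureTheory ProbabilityTheory
open scoped ProbabilityTheory

/-- **Whiskering invariance of the 2-group Haar measure.**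
Let `G` be a measurable group, `H` a measurable space with a measurable left `G`-action,
`σ` an s-finite left-translation-invariant measure on `G`, and `ν` an s-finite
`G`-equivariant kernel from `G` to `H` (a `G`-equivariant Haar system:
`ν (a * b) = (ν b).map (a • ·)` for all `a b`).  Then the 2-group Haar measure
`μ = σ ⊗ₘ ν` on `G × H` is invariant under every whiskering map
`(b, γ) ↦ (a * b, a • γ)`. -/
theorem twoGroup_haar_measure_whiskering_invariant
    {G H : Type*} [Group G] [MeasurableSpace G] [MeasurableMul₂ G]
    [MulAction G H] [MeasurableSpace H] [MeasurableSMul G H]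
    (σ : Measure G) [SFinite σ] [σ.IsMulLeftInvariant]
    (ν : Kernel G H) [IsSFiniteKernel ν]
    (hν : ∀ a b : G, ν (a * b) = (ν b).map (a • ·)) :
    ∀ a : G,
      Measure.map (fun p : G × H => (a * p.1, a • p.2)) (σ ⊗ₘ ν) = σ ⊗ₘ ν := by
  intro a
  have hf : Measurable (fun p : G × H => (a * p.1, a • p.2)) :=
    (measurable_fst.const_mul a).prodMk (measurable_snd.const_smul a)
  ext s hs
  rw [Measure.map_apply hf hs, Measure.compProd_apply (hf hs), Measure.compProd_apply hs,
    ← lintegral_mul_left_eq_self (fun b => ν b (Prod.mk b ⁻¹' s)) a]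
  refine lintegral_congr fun b => ?_
  rw [hν, Measure.map_apply (measurable_const_smul a) (measurable_prodMk_left hs)]
  rfl
end

section
/- Let k be a commutative ring, H a Hopf algebra over k with comultiplication Δ and bijective antipode S, and M a k-module. Let l : H → End(M) and U : H → End(M) be k-algebra homomorphisms which commute in the sense that U(a) ∘ l(b) = l(b) ∘ U(a) for all a, b ∈ H, and let ρ : H → End(M) be defined by the left-covariance formula ρ(h) = Σ l(h₍₁₎) ∘ U(h₍₂₎). Then left covariance implies right covariance: for all h ∈ H, l(h) = Σ U(S⁻¹(h₍₂₎)) ∘ ρ(h₍₁₎). (This is the statement that every left-covariant 2-graph state is also right-covariant, with the contragredient action given by the inverse antipode.) -/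
open TensorProduct

open Coalgebra HopfAlgebra in
/-- An inverse of the antipode is an antipode for the opposite multiplication. -/
lemma HopfAlgebra.sum_antipode_inv_mul_eq_smul {R A ι : Type*} [CommSemiring R] [Semiring A]
    [HopfAlgebra R A] {T : A →ₗ[R] A} (hT₁ : T ∘ₗ antipode R = LinearMap.id)
    (hT₂ : antipode R ∘ₗ T = LinearMap.id) {a : A} (repr : Repr R a ι) :
    ∑ i ∈ repr.index, T (repr.right i) * repr.left i = counit (R := R) a • 1 := by
  have hT₂' (x : A) : antipode R (T x) = x := LinearMap.congr_fun hT₂ x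
  have hinj : Function.Injective (antipode R (A := A)) :=
    Function.LeftInverse.injective (g := T) (LinearMap.congr_fun hT₁)
  apply hinj
  simp [antipode_mul_antidistrib, hT₂', sum_antipode_mul_eq_smul repr]

/-- **Left covariance implies right covariance.**
Let `k` be a commutative ring, `H` a Hopf algebra over `k` with comultiplication `Δ`
and bijective antipode `S` (with two-sided linear inverse `S⁻¹ = Sinv`), and `M` a
`k`-module.  Let `l, U : H → End(M)` be `k`-algebra homomorphisms which commute
(`U a ∘ l b = l b ∘ U a`), and let `ρ : H → End(M)` be given by the left-covariance
formula `ρ h = Σ l h₍₁₎ ∘ U h₍₂₎`.  Then right covariance holds: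
`l h = Σ U (S⁻¹ h₍₂₎) ∘ ρ h₍₁₎` for all `h`. -/
theorem left_covariance_implies_right_covariance
    {k : Type*} [CommRing k] {H : Type*} [Ring H] [HopfAlgebra k H]
    {M : Type*} [AddCommGroup M] [Module k M]
    (l U : H →ₐ[k] Module.End k M)
    (hcomm : ∀ a b : H, U a * l b = l b * U a)
    (Sinv : H →ₗ[k] H)
    (hSinv₁ : Sinv ∘ₗ HopfAlgebra.antipode (R := k) = LinearMap.id)
    (hSinv₂ : HopfAlgebra.antipode (R := k) ∘ₗ Sinv = LinearMap.id)
    (ρ : H →ₗ[k] Module.End k M)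
    (hρ : ρ = LinearMap.mul' k (Module.End k M) ∘ₗ
        TensorProduct.map l.toLinearMap U.toLinearMap ∘ₗ Coalgebra.comul) :
    l.toLinearMap = LinearMap.mul' k (Module.End k M) ∘ₗ
        TensorProduct.map (U.toLinearMap ∘ₗ Sinv) ρ ∘ₗ
        (TensorProduct.comm k H H).toLinearMap ∘ₗ Coalgebra.comul := by
  ext1 h
  let 𝓡 := Coalgebra.Repr.arbitrary k h
  let 𝓛 := fun i ↦ Coalgebra.Repr.arbitrary k (𝓡.left i)
  let 𝓢 := fun i ↦ Coalgebra.Repr.arbitrary k (𝓡.right i)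
  have hρ_left (i) : ρ (𝓡.left i) =
      ∑ j ∈ (𝓛 i).index, l ((𝓛 i).left j) * U ((𝓛 i).right j) := by
    simp [hρ, ← (𝓛 i).eq]
  have hswap (a b c : H) : U (Sinv c) * (l a * U b) = l a * U (Sinv c * b) := by
    rw [← mul_assoc, hcomm, mul_assoc, map_mul]
  have hcoassoc := congr(LinearMap.mul' k (Module.End k M) (TensorProduct.map l.toLinearMap
    (U.toLinearMap ∘ₗ LinearMap.mul' k H ∘ₗ TensorProduct.map Sinv LinearMap.id ∘ₗ
      (TensorProduct.comm k H H).toLinearMap) $(Coalgebra.sum_tmul_tmul_eq 𝓡 𝓛 𝓢)))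
  simp only [map_sum, TensorProduct.map_tmul, LinearMap.comp_apply, LinearEquiv.coe_coe,
    TensorProduct.comm_tmul, LinearMap.id_apply, LinearMap.mul'_apply,
    AlgHom.toLinearMap_apply] at hcoassoc
  have hcounit := congr(TensorProduct.rid k H $(Coalgebra.sum_tmul_counit_eq 𝓡))
  simp only [map_sum, TensorProduct.rid_tmul, one_smul] at hcounit
  symm
  calc
    _ = ∑ i ∈ 𝓡.index, U (Sinv (𝓡.right i)) * ρ (𝓡.left i) := by
      simp [← 𝓡.eq]
    _ = ∑ i ∈ 𝓡.index, ∑ j ∈ (𝓢 i).index,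
          l (𝓡.left i) * U (Sinv ((𝓢 i).right j) * (𝓢 i).left j) := by
      simp only [hρ_left, Finset.mul_sum, hswap, hcoassoc]
    _ = ∑ i ∈ 𝓡.index, l (Coalgebra.counit (R := k) (𝓡.right i) • 𝓡.left i) := by
      refine Finset.sum_congr rfl fun i _ ↦ ?_
      rw [← Finset.mul_sum, ← map_sum,
        HopfAlgebra.sum_antipode_inv_mul_eq_smul hSinv₁ hSinv₂ (𝓢 i), map_smul, map_one,
        mul_smul_comm, mul_one, map_smul]
    _ = l.toLinearMap h := by
      rw [← map_sum, hcounit, AlgHom.toLinearMap_apply]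
end
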